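/- Let k ≥ 1 be an integer, 0 < d < 1/2, L slowly varying at infinity, and a_i = i^{d-1} L(i) for i ≥ 1 (with a_i = 0 for i ≤ 0). Define γ(n) = ∑_{1 ≤ i_1 < ⋯ < i_k < ∞} a_{n+i_1} a_{i_1} ⋯ a_{n+i_k} a_{i_k} for n ≥ 0. Then γ(n) / (n^{k(2d-1)} L(n)^{2k}) → B(d, 1-2d)^k / k! as n → ∞, where B is the Beta function. Equivalently, γ(n) = n^{2 d_X - 1} L*(n) where d_X = 1/2 - k(1/2 - d) and L*(n) = (k!)^{-1} B(d,1-2d)^k L(n)^{2k} is slowly varying. -/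

import Mathlib

open Filter Topology

/-- A measurable function `L : ℝ → ℝ` is slowly varying at infinity. -/
def SlowlyVaryingAtTop (L : ℝ → ℝ) : Prop :=
  Measurable L ∧ (∀ᶠ x in atTop, 0 < L x) ∧
    ∀ l : ℝ, 0 < l → Tendsto (fun x => L (l * x) / L x) atTop (𝓝 1)

/-- Strictly increasing `k`-tuples of positive natural numbers `1 ≤ i_1 < ⋯ < i_k`. -/
def IncrTuple (k : ℕ) : Type := {f : Fin k → ℕ // StrictMono f ∧ ∀ j, 0 < f j}

/-- The `k`-th elementary symmetric function of a sequence. -/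
noncomputable def infEsymm (c : ℕ → ℝ) (k : ℕ) : ℝ :=
  ∑' s : {s : Finset ℕ // s.card = k}, ∏ i ∈ s.1, c i

theorem tsum_incrTuple (b : ℕ → ℝ) (k : ℕ) :
    ∑' i : IncrTuple k, ∏ j, b (i.1 j) = infEsymm (fun i => b (i + 1)) k := by
  let e : {s : Finset ℕ // s.card = k} → IncrTuple k := fun s =>
    ⟨fun j => s.1.orderEmbOfFin s.2 j + 1,
      fun x y h => Nat.add_lt_add_right ((s.1.orderEmbOfFin s.2).strictMono h) 1,
      fun j => Nat.succ_pos _⟩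
  have he : Function.Bijective e := by
    constructor
    · intro s t h
      have h1 : ∀ j, s.1.orderEmbOfFin s.2 j = t.1.orderEmbOfFin t.2 j := fun j => by
        have := congrFun (congrArg Subtype.val h) j
        simpa [e] using this
      apply Subtype.ext
      rw [← Finset.image_orderEmbOfFin_univ s.1 s.2, ← Finset.image_orderEmbOfFin_univ t.1 t.2]
      exact Finset.image_congr fun j _ => h1 j
    · rintro ⟨f, hf, hpos⟩
      have hg : StrictMono fun j => f j - 1 := fun x y h => by
        have h1 := hf h
        have h2 := hpos x
        show f x - 1 < f y - 1
        omega
      refine ⟨⟨Finset.univ.image fun j => f j - 1, ?_⟩, ?_⟩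
      · rw [Finset.card_image_of_injective _ hg.injective, Finset.card_fin]
      · apply Subtype.ext
        funext j
        have hu := Finset.orderEmbOfFin_unique (s := Finset.univ.image fun j => f j - 1) (k := k)
          (by rw [Finset.card_image_of_injective _ hg.injective, Finset.card_fin])
          (f := fun j => f j - 1) (fun x => Finset.mem_image_of_mem _ (Finset.mem_univ x)) hg
        have h2 := congrFun hu j
        have h3 := hpos j
        simp only [e]
        rw [← h2]
        omega
  rw [infEsymm, ← (Equiv.ofBijective e he).tsum_eq]
  refine tsum_congr fun s => ?_
  calc ∏ j, b (s.1.orderEmbOfFin s.2 j + 1)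
      = ∏ i ∈ Finset.univ.image (s.1.orderEmbOfFin s.2), b (i + 1) := by
        rw [Finset.prod_image fun x _ y _ h => (s.1.orderEmbOfFin s.2).injective h]
    _ = ∏ i ∈ s.1, b (i + 1) := by rw [Finset.image_orderEmbOfFin_univ]

theorem infEsymm_const_mul (c : ℕ → ℝ) (r : ℝ) (k : ℕ) :
    infEsymm (fun i => r * c i) k = r ^ k * infEsymm c k := by
  rw [infEsymm, infEsymm, ← tsum_mul_left]
  refine tsum_congr fun s => ?_
  rw [Finset.prod_mul_distrib, Finset.prod_const, s.2]

theorem tendsto_sum_powersetCard {c : ℕ → ℝ} (hc : Summable c) (k : ℕ) :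
    Tendsto (fun N : ℕ => ∑ s ∈ (Finset.range N).powersetCard k, ∏ i ∈ s, c i) atTop
      (𝓝 (infEsymm c k)) := by
  have hs : Summable fun s : Finset ℕ => ∏ i ∈ s, c i :=
    summable_finsetProd_of_summable_norm hc.norm
  have h1 := (hs.indicator {s : Finset ℕ | s.card = k}).hasSum
  have h2 : (∑' s, Set.indicator {s : Finset ℕ | s.card = k} (fun s => ∏ i ∈ s, c i) s)
      = infEsymm c k := (tsum_subtype {s : Finset ℕ | s.card = k} _).symm
  rw [h2] at h1
  have h3 : Tendsto (fun N : ℕ => (Finset.range N).powerset) atTop atTop := by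
    refine tendsto_atTop_finset_of_monotone ?_ ?_
    · intro m n h
      exact Finset.powerset_mono.2 (Finset.range_mono h)
    · intro s
      obtain ⟨N, hN⟩ := s.exists_nat_subset_range
      exact ⟨N, Finset.mem_powerset.2 hN⟩
  refine (h1.comp h3).congr fun N => ?_
  simp only [Function.comp]
  rw [Finset.powersetCard_eq_filter, Finset.sum_filter]
  refine Finset.sum_congr rfl fun s _ => ?_
  simp [Set.indicator_apply]

theorem newton_finset (S : Finset ℕ) (c : ℕ → ℝ) (m : ℕ) :
    ((m + 1 : ℕ) : ℝ) * ∑ s ∈ S.powersetCard (m + 1), ∏ i ∈ s, c i = (-1) ^ m *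
      ∑ l ∈ Finset.range (m + 1),
        (-1) ^ l * (∑ s ∈ S.powersetCard l, ∏ i ∈ s, c i) * ∑ i ∈ S, c i ^ (m - l + 1) := by
  have h := congrArg (MvPolynomial.aeval fun x : S => c x)
    (MvPolynomial.mul_esymm_eq_sum S ℝ (m + 1))
  have he : ∀ m, MvPolynomial.aeval (fun x : S => c x) (MvPolynomial.esymm S ℝ m)
      = ∑ s ∈ S.powersetCard m, ∏ i ∈ s, c i := fun m => by
    rw [MvPolynomial.aeval_esymm_eq_multiset_esymm, ← Finset.esymm_map_val]
    congr 1
    exact (Multiset.map_map c Subtype.val S.attach.val).symm.trans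
      (congrArg (Multiset.map c) (Multiset.attach_map_val S.val))
  have hp : ∀ m, MvPolynomial.aeval (fun x : S => c x) (MvPolynomial.psum S ℝ m)
      = ∑ i ∈ S, c i ^ m := fun m => by
    simp only [MvPolynomial.psum, map_sum, map_pow, MvPolynomial.aeval_X]
    exact Finset.sum_coe_sort S fun i => c i ^ m
  simp only [map_mul, map_sum, map_pow, map_neg, map_one, map_natCast, he, hp] at h
  rw [h, Finset.sum_filter, Finset.Nat.sum_antidiagonal_eq_sum_range_succ_mk,
    Finset.sum_range_succ, if_neg (lt_irrefl _), add_zero, pow_succ, pow_succ, mul_assoc _ (-1 : ℝ) (-1)]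
  norm_num only [mul_one]
  congr 1
  refine Finset.sum_congr rfl fun l hl => ?_
  have hl' := Finset.mem_range.1 hl
  rw [if_pos hl', Nat.sub_add_comm (Nat.le_of_lt_succ hl')]

theorem summable_pow_of_abs_le {c : ℕ → ℝ} (hc : Summable c) {s : ℝ} (hs : ∀ i, |c i| ≤ s)
    (m : ℕ) : Summable (fun i => c i ^ (m + 1)) ∧
      |∑' i, c i ^ (m + 1)| ≤ s ^ m * ∑' i, |c i| := by
  have hb : ∀ i, ‖c i ^ (m + 1)‖ ≤ s ^ m * |c i| := fun i => by
    rw [Real.norm_eq_abs, abs_pow, pow_succ]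
    have := hs i
    gcongr
  have hsum : Summable fun i => s ^ m * |c i| := hc.abs.mul_left _
  refine ⟨hsum.of_norm_bounded hb, ?_⟩
  rw [← tsum_mul_left, ← Real.norm_eq_abs]
  exact tsum_of_norm_bounded hsum.hasSum hb

theorem newton_infEsymm {c : ℕ → ℝ} (hc : Summable c) {s : ℝ} (hs : ∀ i, |c i| ≤ s) (m : ℕ) :
    ((m + 1 : ℕ) : ℝ) * infEsymm c (m + 1) = (-1) ^ m *
      ∑ l ∈ Finset.range (m + 1), (-1) ^ l * infEsymm c l * ∑' i, c i ^ (m - l + 1) := by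
  refine tendsto_nhds_unique ((tendsto_sum_powersetCard hc (m + 1)).const_mul _) ?_
  simp_rw [newton_finset]
  exact (tendsto_finsetSum _ fun l _ => ((tendsto_sum_powersetCard hc l).const_mul _).mul
    (summable_pow_of_abs_le hc hs (m - l)).1.hasSum.tendsto_sum_nat).const_mul _

theorem tendsto_infEsymm {c : ℕ → ℕ → ℝ} {B K : ℝ} {s : ℕ → ℝ}
    (hs : Tendsto s atTop (𝓝 0))
    (hc : ∀ᶠ n in atTop, Summable (c n) ∧ ∑' i, |c n i| ≤ K ∧ ∀ i, |c n i| ≤ s n)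
    (hB : Tendsto (fun n => ∑' i, c n i) atTop (𝓝 B)) (k : ℕ) :
    Tendsto (fun n => infEsymm (c n) k) atTop (𝓝 (B ^ k / (k.factorial : ℝ))) := by
  induction k using Nat.strong_induction_on with
  | _ k ih =>
  rcases k with _ | m
  · have h0 : ∀ c : ℕ → ℝ, infEsymm c 0 = 1 := fun c => by
      rw [infEsymm, tsum_eq_single ⟨∅, Finset.card_empty⟩]
      · simp
      · rintro ⟨s, hs⟩ h
        exact absurd (Subtype.ext (Finset.card_eq_zero.1 hs)) h
    simp [h0]
  have hzero : ∀ p, Tendsto (fun n => ∑' i, c n i ^ (p + 1 + 1)) atTop (𝓝 0) := fun p => by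
    have hlim : Tendsto (fun n => s n ^ (p + 1) * K) atTop (𝓝 0) := by
      simpa using (hs.pow (p + 1)).mul_const K
    refine squeeze_zero_norm' ?_ hlim
    filter_upwards [hc] with n hn
    have hsn : 0 ≤ s n := (abs_nonneg _).trans (hn.2.2 0)
    exact (summable_pow_of_abs_le hn.1 hn.2.2 (p + 1)).2.trans
      (mul_le_mul_of_nonneg_left hn.2.1 (pow_nonneg hsn _))
  have hsum : Tendsto (fun n => ∑ l ∈ Finset.range (m + 1),
      (-1) ^ l * infEsymm (c n) l * ∑' i, c n i ^ (m - l + 1)) atTop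
      (𝓝 (0 + (-1) ^ m * (B ^ m / (m.factorial : ℝ)) * B)) := by
    simp_rw [Finset.sum_range_succ]
    refine Tendsto.add ?_ ?_
    · rw [← Finset.sum_const_zero (s := Finset.range m)]
      refine tendsto_finsetSum _ fun l hl => ?_
      have hl' := Finset.mem_range.1 hl
      obtain ⟨p, hp⟩ : ∃ p, m - l = p + 1 := ⟨m - l - 1, by omega⟩
      rw [hp]
      simpa using ((ih l (by omega)).const_mul _).mul (hzero p)
    · simpa using ((ih m (by omega)).const_mul _).mul hB
  have hfin := (hsum.const_mul ((-1 : ℝ) ^ m)).const_mul (((m + 1 : ℕ) : ℝ)⁻¹)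
  have hm : ((m + 1 : ℕ) : ℝ) ≠ 0 := Nat.cast_ne_zero.2 (Nat.succ_ne_zero m)
  have hval : ((m + 1 : ℕ) : ℝ)⁻¹ *
      ((-1) ^ m * (0 + (-1) ^ m * (B ^ m / (m.factorial : ℝ)) * B))
      = B ^ (m + 1) / ((m + 1).factorial : ℝ) := by
    have h1 : ((-1 : ℝ) ^ m) * (-1) ^ m = 1 := by rw [← mul_pow]; norm_num
    rw [Nat.factorial_succ, Nat.cast_mul, zero_add,
      mul_assoc ((-1 : ℝ) ^ m), ← mul_assoc ((-1 : ℝ) ^ m) ((-1 : ℝ) ^ m), h1]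
    field_simp
    ring
  rw [hval] at hfin
  refine hfin.congr' ?_
  filter_upwards [hc] with n hn
  rw [← newton_infEsymm hn.1 hn.2.2 m, inv_mul_cancel_left₀ hm]

open MeasureTheory in
/-- Uniform convergence theorem for slowly varying functions, in additive form. -/
theorem exists_forall_abs_sub_le_of_tendsto_sub {h : ℝ → ℝ} (hm : Measurable h)
    (hlim : ∀ u, Tendsto (fun x => h (x + u) - h x) atTop (𝓝 0)) {ε : ℝ} (hε : 0 < ε) :
    ∃ X, ∀ x, X ≤ x → ∀ u, 0 ≤ u → u ≤ 1 → |h (x + u) - h x| ≤ ε := by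
  by_contra! hcon
  choose x hx u hu0 hu1 hxu using fun n : ℕ => hcon n
  have hxt : Tendsto x atTop atTop := tendsto_atTop_mono hx tendsto_natCast_atTop_atTop
  have key : ∀ y : ℕ → ℝ, Tendsto y atTop atTop → ∀ᶠ n in atTop,
      volume ({t | ENNReal.ofReal (ε / 2) ≤ edist (h (y n + t) - h (y n)) 0} ∩ Set.Icc 0 2)
        < 1 / 2 := by
    intro y hy
    have hT : TendstoInMeasure (volume.restrict (Set.Icc (0 : ℝ) 2))
        (fun n t => h (y n + t) - h (y n)) atTop (fun _ => (0 : ℝ)) := by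
      refine tendstoInMeasure_of_tendsto_ae (fun n => ?_) ?_
      · exact ((hm.comp (measurable_const_add _)).sub_const _).aestronglyMeasurable
      · exact Eventually.of_forall fun t => (hlim t).comp hy
    have h1 := (hT (ENNReal.ofReal (ε / 2)) (by simpa using hε)).eventually_lt_const
      (u := 1 / 2) (by norm_num)
    filter_upwards [h1] with n hn
    rwa [Measure.restrict_apply' measurableSet_Icc] at hn
  obtain ⟨n, h1, h2⟩ := ((key x hxt).and (key (fun n => x n + u n)
    (tendsto_atTop_mono (fun n => le_add_of_nonneg_right (hu0 n)) hxt))).exists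
  set A := {t | ENNReal.ofReal (ε / 2) ≤ edist (h (x n + t) - h (x n)) 0} ∩ Set.Icc 0 2
  set C := {t | ENNReal.ofReal (ε / 2) ≤ edist (h (x n + u n + t) - h (x n + u n)) 0}
    ∩ Set.Icc 0 2
  have hsub : Set.Icc (0 : ℝ) 1 ⊆ C ∪ (fun s => s + u n) ⁻¹' A := by
    intro s hs
    by_contra hcs
    rw [Set.mem_union, not_or] at hcs
    have hC : |h (x n + u n + s) - h (x n + u n)| < ε / 2 := by
      by_contra! hle
      refine hcs.1 ⟨?_, hs.1, by linarith [hs.2]⟩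
      rw [Set.mem_ofPred_eq, edist_dist, Real.dist_eq, sub_zero]
      exact ENNReal.ofReal_le_ofReal hle
    have hA : |h (x n + (s + u n)) - h (x n)| < ε / 2 := by
      by_contra! hle
      refine hcs.2 ⟨?_, add_nonneg hs.1 (hu0 n), by linarith [hs.2, hu1 n]⟩
      rw [Set.mem_ofPred_eq, edist_dist, Real.dist_eq, sub_zero]
      exact ENNReal.ofReal_le_ofReal hle
    have h3 := hxu n
    rw [show x n + (s + u n) = x n + u n + s by ring] at hA
    rw [abs_lt] at hA hC
    exact absurd h3 (not_lt.2 (abs_le.2 ⟨by linarith, by linarith⟩))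
  have h4 : (1 : ENNReal) ≤ volume C + volume A := by
    calc (1 : ENNReal) = volume (Set.Icc (0 : ℝ) 1) := by simp
      _ ≤ volume (C ∪ (fun s => s + u n) ⁻¹' A) := measure_mono hsub
      _ ≤ volume C + volume ((fun s => s + u n) ⁻¹' A) := measure_union_le _ _
      _ = volume C + volume A := by rw [measure_preimage_add_right]
  have h5 := ENNReal.add_lt_add h2 h1
  rw [ENNReal.add_halves] at h5
  exact absurd h4 (not_le.2 h5)

theorem abs_sub_le_mul_add_of_forall {h : ℝ → ℝ} {X δ : ℝ} (hδ : 0 ≤ δ)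
    (hX : ∀ x, X ≤ x → ∀ u, 0 ≤ u → u ≤ 1 → |h (x + u) - h x| ≤ δ) {x v : ℝ} (hx : X ≤ x)
    (hv : 0 ≤ v) : |h (x + v) - h x| ≤ δ * v + δ := by
  have key : ∀ m : ℕ, ∀ x : ℝ, X ≤ x → ∀ v : ℝ, 0 ≤ v → v ≤ (m : ℝ) + 1 →
      |h (x + v) - h x| ≤ δ * v + δ := by
    intro m
    induction m with
    | zero =>
      intro x hx v hv0 hv1
      have := hX x hx v hv0 (by simpa using hv1)
      nlinarith
    | succ m ih =>
      intro x hx v hv0 hv1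
      push_cast at hv1
      rcases le_total v 1 with h1 | h1
      · have := hX x hx v hv0 h1
        nlinarith
      · have h2 := ih (x + 1) (by linarith) (v - 1) (by linarith) (by linarith)
        have h3 := hX x hx 1 zero_le_one le_rfl
        rw [show x + 1 + (v - 1) = x + v by ring] at h2
        rw [abs_le] at *
        constructor <;> linarith [h2.1, h2.2, h3.1, h3.2]
  obtain ⟨m, hm⟩ := exists_nat_ge v
  exact key m x hx v hv (by linarith)

namespace SlowlyVaryingAtTop

variable {L : ℝ → ℝ}

theorem exists_pos (hL : SlowlyVaryingAtTop L) : ∃ X, 0 < X ∧ ∀ x, X ≤ x → 0 < L x := by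
  obtain ⟨X, hX⟩ := eventually_atTop.1 hL.2.1
  exact ⟨max X 1, by positivity, fun x hx => hX x ((le_max_left _ _).trans hx)⟩

theorem tendsto_log_comp_exp (hL : SlowlyVaryingAtTop L) (u : ℝ) :
    Tendsto (fun x => Real.log (L (Real.exp (x + u))) - Real.log (L (Real.exp x))) atTop
      (𝓝 0) := by
  have h1 := (hL.2.2 (Real.exp u) (Real.exp_pos u)).comp Real.tendsto_exp_atTop
  have h2 := h1.log one_ne_zero
  rw [Real.log_one] at h2
  refine h2.congr' ?_
  have h3 : Tendsto (fun x => Real.exp (x + u)) atTop atTop :=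
    Real.tendsto_exp_atTop.comp (tendsto_atTop_add_const_right _ _ tendsto_id)
  filter_upwards [Real.tendsto_exp_atTop.eventually hL.2.1, h3.eventually hL.2.1] with x hx hxu
  rw [Function.comp_apply, ← Real.exp_add, add_comm u x, Real.log_div hxu.ne' hx.ne']

theorem exists_uniform (hL : SlowlyVaryingAtTop L) {ε : ℝ} (hε : 0 < ε) :
    ∃ X, ∀ x, X ≤ x → ∀ u, 0 ≤ u → u ≤ 1 →
      |Real.log (L (Real.exp (x + u))) - Real.log (L (Real.exp x))| ≤ ε :=
  exists_forall_abs_sub_le_of_tendsto_sub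
    (h := fun x => Real.log (L (Real.exp x)))
    (Real.measurable_log.comp (hL.1.comp Real.measurable_exp)) hL.tendsto_log_comp_exp hε

/-- Potter's bound in logarithmic form. -/
theorem exists_abs_log_sub_le (hL : SlowlyVaryingAtTop L) {δ : ℝ} (hδ : 0 < δ) :
    ∃ X, 0 < X ∧ (∀ x, X ≤ x → 0 < L x) ∧ ∀ x y, X ≤ x → X ≤ y →
      |Real.log (L y) - Real.log (L x)| ≤ δ * |Real.log (y / x)| + δ := by
  obtain ⟨X₀, hX₀, hpos⟩ := hL.exists_pos
  obtain ⟨X₁, hX₁⟩ := hL.exists_uniform hδ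
  have key : ∀ x y, max X₀ (Real.exp X₁) ≤ x → x ≤ y →
      |Real.log (L y) - Real.log (L x)| ≤ δ * |Real.log (y / x)| + δ := by
    intro x y hx hxy
    have hx0 : 0 < x := hX₀.trans_le ((le_max_left _ _).trans hx)
    have hy0 : 0 < y := hx0.trans_le hxy
    have hlog : 0 ≤ Real.log (y / x) := Real.log_nonneg ((one_le_div hx0).2 hxy)
    have hX₁x : X₁ ≤ Real.log x :=
      (Real.le_log_iff_exp_le hx0).2 ((le_max_right _ _).trans hx)
    have h1 := abs_sub_le_mul_add_of_forall (h := fun x => Real.log (L (Real.exp x)))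
      hδ.le hX₁ hX₁x hlog
    simp only [Real.log_div hy0.ne' hx0.ne', add_sub_cancel, Real.exp_log hx0,
      Real.exp_log hy0] at h1
    rwa [abs_of_nonneg hlog, Real.log_div hy0.ne' hx0.ne']
  refine ⟨max X₀ (Real.exp X₁), lt_max_of_lt_left hX₀,
    fun x hx => hpos x ((le_max_left _ _).trans hx), fun x y hx hy => ?_⟩
  rcases le_total x y with h | h
  · exact key x y hx h
  · have := key y x hy h
    rwa [abs_sub_comm, ← inv_div, Real.log_inv, abs_neg] at this

theorem exists_le_mul_rpow (hL : SlowlyVaryingAtTop L) {δ : ℝ} (hδ : 0 < δ) :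
    ∃ X, 0 < X ∧ (∀ x, X ≤ x → 0 < L x) ∧ ∀ x y, X ≤ x → X ≤ y →
      L y ≤ Real.exp δ * L x * ((y / x) ^ δ + (y / x) ^ (-δ)) := by
  obtain ⟨X, hX, hpos, h⟩ := hL.exists_abs_log_sub_le hδ
  refine ⟨X, hX, hpos, fun x y hx hy => ?_⟩
  have hr : 0 < y / x := div_pos (hX.trans_le hy) (hX.trans_le hx)
  have h1 := (le_abs_self _).trans (h x y hx hy)
  calc L y = Real.exp (Real.log (L y)) := (Real.exp_log (hpos y hy)).symm
    _ ≤ Real.exp (δ + Real.log (L x) + δ * |Real.log (y / x)|) :=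
        Real.exp_le_exp.2 (by linarith)
    _ = Real.exp δ * L x * Real.exp (δ * |Real.log (y / x)|) := by
        rw [Real.exp_add, Real.exp_add, Real.exp_log (hpos x hx)]
    _ ≤ Real.exp δ * L x * ((y / x) ^ δ + (y / x) ^ (-δ)) := by
        have := hpos x hx
        refine mul_le_mul_of_nonneg_left ?_ (by positivity)
        rw [Real.rpow_def_of_pos hr, Real.rpow_def_of_pos hr]
        rcases abs_cases (Real.log (y / x)) with ⟨h2, -⟩ | ⟨h2, -⟩ <;> rw [h2]
        · rw [mul_comm δ]
          exact le_add_of_nonneg_right (Real.exp_pos _).le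
        · rw [mul_neg, mul_neg, mul_comm δ]
          exact le_add_of_nonneg_left (Real.exp_pos _).le

/-- Potter's bound along the integers, uniform down to `i = 1`. -/
theorem exists_nat_abs_le (hL : SlowlyVaryingAtTop L) {δ : ℝ} (hδ : 0 < δ) :
    ∃ C, 0 < C ∧ ∃ N : ℕ, 1 ≤ N ∧ ∀ n : ℕ, N ≤ n → 0 < L n ∧ ∀ i : ℕ, 1 ≤ i →
      |L i| ≤ C * L n * (((i : ℝ) / n) ^ δ + ((i : ℝ) / n) ^ (-δ)) := by
  obtain ⟨X, hX, hpos, h⟩ := hL.exists_le_mul_rpow hδ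
  obtain ⟨M, hM⟩ := exists_nat_ge X
  have hM0 : (0 : ℝ) < M := hX.trans_le hM
  have hM1 : 1 ≤ M := Nat.cast_pos.1 hM0
  have hge : ∀ n : ℕ, M ≤ n → X ≤ n := fun n hn => hM.trans (Nat.cast_le.2 hn)
  have hLM := hpos M hM
  set K := ∑ i ∈ Finset.range M, |L i|
  have hK : 0 ≤ K := Finset.sum_nonneg fun _ _ => abs_nonneg _
  refine ⟨Real.exp δ * (1 + 2 * (K / L M)), by positivity, M, hM1, fun n hn => ⟨hpos n (hge n hn),
    fun i hi => ?_⟩⟩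
  have hLn := hpos n (hge n hn)
  have hn0 : (0 : ℝ) < n := hM0.trans_le (Nat.cast_le.2 hn)
  have hi0 : (0 : ℝ) < i := Nat.cast_pos.2 hi
  rcases le_or_gt M i with hiM | hiM
  · have h1 := h n i (hge n hn) (hge i hiM)
    rw [abs_of_pos (hpos i (hge i hiM))]
    refine h1.trans ?_
    have : 0 ≤ K / L M := by positivity
    gcongr
    have := Real.exp_pos δ
    nlinarith
  · have h1 := h n M (hge n hn) hM
    have h2 : |L i| ≤ K := Finset.single_le_sum (f := fun i : ℕ => |L i|)
      (fun _ _ => abs_nonneg _) (Finset.mem_range.2 hiM)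
    have h3 : ((M : ℝ) / n) ^ δ + ((M : ℝ) / n) ^ (-δ) ≤ 2 * ((i : ℝ) / n) ^ (-δ) := by
      have hMn : (M : ℝ) / n ≤ 1 := (div_le_one hn0).2 (Nat.cast_le.2 hn)
      have hMn0 : 0 < (M : ℝ) / n := by positivity
      have h4 : ((M : ℝ) / n) ^ δ ≤ ((M : ℝ) / n) ^ (-δ) :=
        Real.rpow_le_rpow_of_exponent_ge hMn0 hMn (by linarith)
      have h5 : ((M : ℝ) / n) ^ (-δ) ≤ ((i : ℝ) / n) ^ (-δ) := by
        refine Real.rpow_le_rpow_of_nonpos (by positivity) ?_ (by linarith)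
        have : (i : ℝ) ≤ M := Nat.cast_le.2 hiM.le
        gcongr
      linarith
    have h6 : 0 < ((i : ℝ) / n) ^ (-δ) := by positivity
    have h7 : 0 < ((i : ℝ) / n) ^ δ := by positivity
    calc |L i| ≤ K := h2
      _ = K / L M * L M := by field_simp
      _ ≤ K / L M * (Real.exp δ * L n * (2 * ((i : ℝ) / n) ^ (-δ))) := by
          refine mul_le_mul_of_nonneg_left (h1.trans ?_) (by positivity)
          gcongr
      _ = Real.exp δ * (2 * (K / L M)) * L n * ((i : ℝ) / n) ^ (-δ) := by ring
      _ ≤ Real.exp δ * (1 + 2 * (K / L M)) * L n *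
          (((i : ℝ) / n) ^ δ + ((i : ℝ) / n) ^ (-δ)) := by
          gcongr <;> linarith

theorem tendsto_natCeil_div (hL : SlowlyVaryingAtTop L) {v : ℝ} (hv : 0 < v) :
    Tendsto (fun n : ℕ => L (⌈n * v⌉₊ : ℕ) / L n) atTop (𝓝 1) := by
  have hnv : Tendsto (fun n : ℕ => (n : ℝ) * v) atTop atTop :=
    tendsto_natCast_atTop_atTop.atTop_mul_const hv
  have hlog : Tendsto (fun n : ℕ => Real.log (L (⌈n * v⌉₊ : ℕ)) - Real.log (L (n * v))) atTop
      (𝓝 0) := by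
    rw [Metric.tendsto_atTop']
    intro ε hε
    obtain ⟨X, hX⟩ := hL.exists_uniform (half_pos hε)
    obtain ⟨N, hN⟩ := eventually_atTop.1
      (hnv.eventually_ge_atTop (max (Real.exp X) 1))
    refine ⟨N, fun n hn => ?_⟩
    have h1 := hN n hn.le
    have h2 : 1 ≤ n * v := (le_max_right _ _).trans h1
    have h0 : 0 < n * v := one_pos.trans_le h2
    have h3 : n * v ≤ (⌈n * v⌉₊ : ℕ) := Nat.le_ceil _
    have h4 : ((⌈n * v⌉₊ : ℕ) : ℝ) ≤ 2 * (n * v) := by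
      linarith [Nat.ceil_lt_add_one h0.le]
    have hc0 : 0 < ((⌈n * v⌉₊ : ℕ) : ℝ) := h0.trans_le h3
    have h5 := hX (Real.log (n * v))
      ((Real.le_log_iff_exp_le h0).2 ((le_max_left _ _).trans h1))
      (Real.log (((⌈n * v⌉₊ : ℕ) : ℝ) / (n * v)))
      (Real.log_nonneg ((one_le_div h0).2 h3))
      (by
        refine (Real.log_le_iff_le_exp (by positivity)).2 (((div_le_iff₀ h0).2 h4).trans ?_)
        linarith [Real.add_one_le_exp (1 : ℝ)])
    rw [Real.log_div hc0.ne' h0.ne', add_sub_cancel, Real.exp_log hc0, Real.exp_log h0] at h5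
    rw [Real.dist_eq, sub_zero]
    linarith
  have h6 : Tendsto (fun n : ℕ => L (v * n) / L n) atTop (𝓝 1) :=
    (hL.2.2 v hv).comp tendsto_natCast_atTop_atTop
  have h7 := (Real.continuous_exp.tendsto 0).comp hlog
  rw [Real.exp_zero] at h7
  have h8 := h7.mul h6
  rw [mul_one] at h8
  refine h8.congr' ?_
  have hceil : Tendsto (fun n : ℕ => ((⌈n * v⌉₊ : ℕ) : ℝ)) atTop atTop :=
    tendsto_atTop_mono (fun n => Nat.le_ceil _) hnv
  filter_upwards [hnv.eventually hL.2.1, hceil.eventually hL.2.1] with n h9 h10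
  rw [Function.comp_apply, Real.exp_sub, Real.exp_log h9, Real.exp_log h10, mul_comm v]
  field_simp

end SlowlyVaryingAtTop

section Integrals

open MeasureTheory

theorem integral_Ioo_rpow_mul_one_sub_rpow {u v : ℝ} (hu : 0 < u) (hv : 0 < v) :
    ∫ t in Set.Ioo (0 : ℝ) 1, t ^ (u - 1) * (1 - t) ^ (v - 1) = ProbabilityTheory.beta u v := by
  have h1 : Complex.betaIntegral u v =
      ((∫ t in Set.Ioo (0 : ℝ) 1, t ^ (u - 1) * (1 - t) ^ (v - 1) : ℝ) : ℂ) := by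
    rw [Complex.betaIntegral, intervalIntegral.integral_of_le zero_le_one,
      integral_Ioc_eq_integral_Ioo, ← integral_complex_ofReal]
    refine setIntegral_congr_fun measurableSet_Ioo fun t ht => ?_
    rw [Complex.ofReal_mul, Complex.ofReal_cpow ht.1.le, Complex.ofReal_cpow (by linarith [ht.2])]
    push_cast
    rfl
  rw [ProbabilityTheory.beta_eq_betaIntegralReal u v hu hv, h1, Complex.ofReal_re]

theorem integral_Ioi_rpow_mul_one_add_rpow {d : ℝ} (hd0 : 0 < d) (hd2 : d < 1 / 2) :
    ∫ u in Set.Ioi (0 : ℝ), u ^ (d - 1) * (1 + u) ^ (d - 1) =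
      Real.Gamma d * Real.Gamma (1 - 2 * d) / Real.Gamma (1 - d) := by
  have him : (fun t : ℝ => t / (1 - t)) '' Set.Ioo 0 1 = Set.Ioi 0 := by
    ext y
    constructor
    · rintro ⟨t, ht, rfl⟩
      exact div_pos ht.1 (by linarith [ht.2])
    · intro hy
      have hy0 : 0 < y := hy
      refine ⟨y / (1 + y), ⟨by positivity, (div_lt_one (by positivity)).2 (by linarith)⟩, ?_⟩
      simp only
      field_simp
      ring
  have hderiv : ∀ t ∈ Set.Ioo (0 : ℝ) 1,
      HasDerivWithinAt (fun t : ℝ => t / (1 - t)) (((1 - t) ^ 2)⁻¹) (Set.Ioo 0 1) t := by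
    intro t ht
    have h1 : (1 - t) ≠ 0 := by linarith [ht.2]
    have h2 := (hasDerivAt_id t).div ((hasDerivAt_id t).const_sub 1) h1
    refine (h2.congr_deriv ?_).hasDerivWithinAt
    simp only [id]
    field_simp
    ring
  have hinj : Set.InjOn (fun t : ℝ => t / (1 - t)) (Set.Ioo 0 1) := by
    intro s hs t ht h
    have h1 : (1 - s) ≠ 0 := by linarith [hs.2]
    have h2 : (1 - t) ≠ 0 := by linarith [ht.2]
    simp only at h
    rw [div_eq_div_iff h1 h2] at h
    linarith
  rw [← him, integral_image_eq_integral_abs_deriv_smul measurableSet_Ioo hderiv hinj]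
  have hbeta := integral_Ioo_rpow_mul_one_sub_rpow hd0 (v := 1 - 2 * d) (by linarith)
  rw [ProbabilityTheory.beta, show d + (1 - 2 * d) = 1 - d by ring] at hbeta
  rw [← hbeta]
  refine setIntegral_congr_fun measurableSet_Ioo fun t ht => ?_
  have h1 : 0 < 1 - t := by linarith [ht.2]
  simp only [smul_eq_mul]
  rw [show 1 + t / (1 - t) = (1 - t)⁻¹ by field_simp; ring, abs_of_pos (by positivity),
    Real.div_rpow ht.1.le h1.le, Real.inv_rpow h1.le,
    show 1 - 2 * d - 1 = -(d - 1) + -(d - 1) - 2 by ring, Real.rpow_sub h1 _ 2,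
    Real.rpow_add h1,
    Real.rpow_neg h1.le, Real.rpow_two]
  ring

/-- An integrable step function on cells of length `1 / n` sums to its integral. -/
theorem hasSum_of_integrableOn_natCeil {f : ℕ → ℝ} {n : ℕ} (hn : 1 ≤ n)
    (hf : IntegrableOn (fun u : ℝ => f ⌈n * u⌉₊) (Set.Ioi 0)) :
    HasSum (fun i : ℕ => f (i + 1) / n) (∫ u in Set.Ioi (0 : ℝ), f ⌈n * u⌉₊) := by
  have hn0 : (0 : ℝ) < n := Nat.cast_pos.2 hn
  have hcell : ∀ (i : ℕ) (u : ℝ),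
      u ∈ Set.Ioc ((i : ℝ) / n) ((i + 1 : ℝ) / n) ↔ ⌈n * u⌉₊ = i + 1 := by
    intro i u
    rw [Nat.ceil_eq_iff (Nat.succ_ne_zero i), Set.mem_Ioc, div_lt_iff₀' hn0, le_div_iff₀' hn0]
    simp
  have hU : (⋃ i : ℕ, Set.Ioc ((i : ℝ) / n) ((i + 1 : ℝ) / n)) = Set.Ioi 0 := by
    ext u
    rw [Set.mem_iUnion]
    constructor
    · rintro ⟨i, hi⟩
      exact lt_of_le_of_lt (by positivity) hi.1
    · intro hu
      have hpos : 0 < ⌈n * u⌉₊ := Nat.ceil_pos.2 (mul_pos hn0 hu)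
      exact ⟨⌈n * u⌉₊ - 1, (hcell _ _).2 (by omega)⟩
  have hd : Pairwise (Function.onFun Disjoint
      fun i : ℕ => Set.Ioc ((i : ℝ) / n) ((i + 1 : ℝ) / n)) := by
    intro i j hij
    refine Set.disjoint_left.2 fun u hi hj => hij ?_
    have h1 := (hcell i u).1 hi
    have h2 := (hcell j u).1 hj
    omega
  rw [← hU] at hf ⊢
  have hfun : (fun i : ℕ => f (i + 1) / n) = fun i : ℕ =>
      ∫ u in Set.Ioc ((i : ℝ) / n) ((i + 1 : ℝ) / n), f ⌈n * u⌉₊ := by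
    funext i
    rw [setIntegral_congr_fun (g := fun _ => f (i + 1)) measurableSet_Ioc
      (fun u hu => by simp only [(hcell i u).1 hu]), setIntegral_const, measureReal_def,
      Real.volume_Ioc, smul_eq_mul, ENNReal.toReal_ofReal (by rw [← sub_div]; simp)]
    ring
  rw [hfun]
  exact hasSum_integral_iUnion (fun _ => measurableSet_Ioc) hd hf

theorem integrableOn_Ioi_rpow_mul_one_add_rpow {p q : ℝ} (hp : -1 < p) (hq : q ≤ 0)
    (hpq : p + q < -1) :
    IntegrableOn (fun u : ℝ => u ^ p * (1 + u) ^ q) (Set.Ioi 0) := by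
  have hmeas : Measurable (fun u : ℝ => u ^ p * (1 + u) ^ q) := by fun_prop
  rw [← Set.Ioc_union_Ioi_eq_Ioi (zero_le_one (α := ℝ))]
  refine IntegrableOn.union ?_ ?_
  · have h1 : IntegrableOn (fun u : ℝ => u ^ p) (Set.Ioc 0 1) :=
      (intervalIntegrable_iff_integrableOn_Ioc_of_le zero_le_one).1
        (intervalIntegral.intervalIntegrable_rpow' hp)
    refine Integrable.mono' h1 hmeas.aestronglyMeasurable ?_
    filter_upwards [ae_restrict_mem measurableSet_Ioc] with u hu
    have hu0 : 0 < u := hu.1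
    rw [Real.norm_of_nonneg (by positivity)]
    exact mul_le_of_le_one_right (by positivity)
      (Real.rpow_le_one_of_one_le_of_nonpos (by linarith) hq)
  · refine Integrable.mono' (integrableOn_Ioi_rpow_of_lt hpq one_pos)
      hmeas.aestronglyMeasurable ?_
    filter_upwards [ae_restrict_mem measurableSet_Ioi] with u hu
    have hu0 : 0 < u := one_pos.trans hu
    rw [Real.norm_of_nonneg (by positivity), Real.rpow_add hu0]
    exact mul_le_mul_of_nonneg_left
      (Real.rpow_le_rpow_of_nonpos hu0 (by linarith) hq) (by positivity)

end Integrals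

/-- The summand of the autocovariance, rescaled by its order of magnitude. -/
noncomputable def scaledSummand (L : ℝ → ℝ) (d : ℝ) (n m : ℕ) : ℝ :=
  (((n + m : ℕ) : ℝ) / n) ^ (d - 1) * (L (n + m : ℕ) / L n) *
    (((m : ℝ) / n) ^ (d - 1) * (L m / L n))

theorem mul_eq_scaledSummand_div {L : ℝ → ℝ} {d : ℝ} {n m : ℕ} (hn : 1 ≤ n) (hLn : 0 < L n) :
    ((n ^ (2 * d - 1) * L n ^ 2 : ℝ))⁻¹ *
        ((((n + m : ℕ) : ℝ) ^ (d - 1) * L (n + m : ℕ)) * ((m : ℝ) ^ (d - 1) * L m)) =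
      scaledSummand L d n m / n := by
  have hn0 : (0 : ℝ) < n := Nat.cast_pos.2 hn
  rw [scaledSummand, Real.div_rpow (Nat.cast_nonneg _) hn0.le,
    Real.div_rpow (Nat.cast_nonneg _) hn0.le,
    show 2 * d - 1 = (d - 1) + (d - 1) + 1 by ring, Real.rpow_add hn0, Real.rpow_add hn0,
    Real.rpow_one]
  have : (n : ℝ) ^ (d - 1) ≠ 0 := (Real.rpow_pos_of_pos hn0 _).ne'
  field_simp

namespace SlowlyVaryingAtTop

variable {L : ℝ → ℝ} {d : ℝ}

theorem exists_abs_rpow_mul_div_le (hL : SlowlyVaryingAtTop L) {δ : ℝ} (hδ : 0 < δ) :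
    ∃ C, 0 < C ∧ ∃ N : ℕ, 1 ≤ N ∧ ∀ n : ℕ, N ≤ n → 0 < L n ∧ ∀ i : ℕ, 1 ≤ i →
      |((i : ℝ) / n) ^ (d - 1) * (L i / L n)| ≤
        C * (((i : ℝ) / n) ^ (d - 1 + δ) + ((i : ℝ) / n) ^ (d - 1 - δ)) := by
  obtain ⟨C, hC, N, hN, h⟩ := hL.exists_nat_abs_le hδ
  refine ⟨C, hC, N, hN, fun n hn => ⟨(h n hn).1, fun i hi => ?_⟩⟩
  have hLn := (h n hn).1
  have hx : 0 < (i : ℝ) / n := div_pos (Nat.cast_pos.2 hi) (Nat.cast_pos.2 (hN.trans hn))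
  rw [abs_mul, abs_div, abs_of_pos hLn, abs_of_pos (Real.rpow_pos_of_pos hx _),
    sub_eq_add_neg (d - 1) δ, Real.rpow_add hx, Real.rpow_add hx, ← mul_add, mul_left_comm]
  refine mul_le_mul_of_nonneg_left ?_ (by positivity)
  rw [div_le_iff₀ hLn]
  linarith [(h n hn).2 i hi]

theorem exists_abs_scaledSummand_le (hL : SlowlyVaryingAtTop L) (hd0 : 0 < d)
    (hd2 : d < 1 / 2) :
    ∃ α β K : ℝ, -1 < β ∧ β ≤ α ∧ α + α < -1 ∧ 0 < K ∧ ∃ N : ℕ, 1 ≤ N ∧ ∀ n : ℕ, N ≤ n →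
      0 < L n ∧ ∀ m : ℕ, 1 ≤ m → |scaledSummand L d n m| ≤
        K * ((((m : ℝ) / n) ^ α * (1 + (m : ℝ) / n) ^ α) +
          ((m : ℝ) / n) ^ β * (1 + (m : ℝ) / n) ^ α) := by
  obtain ⟨δ, hδ, hδ1, hδ2⟩ : ∃ δ : ℝ, 0 < δ ∧ δ < d ∧ δ < 1 / 2 - d := by
    obtain ⟨δ, h1, h2⟩ := exists_between (lt_min hd0 (sub_pos.2 hd2))
    exact ⟨δ, h1, lt_min_iff.1 h2⟩
  obtain ⟨C, hC, N, hN, h⟩ := hL.exists_abs_rpow_mul_div_le (d := d) hδ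
  refine ⟨d - 1 + δ, d - 1 - δ, 2 * C * C, by linarith, by linarith, by linarith, by positivity,
    N, hN, fun n hn => ⟨(h n hn).1, fun m hm => ?_⟩⟩
  have hn0 : (0 : ℝ) < n := Nat.cast_pos.2 (hN.trans hn)
  have h1 := (h n hn).2 m hm
  have h2 := (h n hn).2 (n + m) (by omega)
  have hx : 0 < (m : ℝ) / n := div_pos (Nat.cast_pos.2 hm) hn0
  have h3 : (((n + m : ℕ) : ℝ) / n) = 1 + (m : ℝ) / n := by
    push_cast
    field_simp
  have h4 : (1 + (m : ℝ) / n) ^ (d - 1 - δ) ≤ (1 + (m : ℝ) / n) ^ (d - 1 + δ) :=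
    Real.rpow_le_rpow_of_exponent_le (by linarith) (by linarith)
  rw [scaledSummand, abs_mul]
  rw [h3] at h2 ⊢
  have h5 : 0 < (1 + (m : ℝ) / n) ^ (d - 1 + δ) := by positivity
  calc _ ≤ (C * (2 * (1 + (m : ℝ) / n) ^ (d - 1 + δ))) *
        (C * (((m : ℝ) / n) ^ (d - 1 + δ) + ((m : ℝ) / n) ^ (d - 1 - δ))) := by
        refine mul_le_mul (h2.trans ?_) h1 (abs_nonneg _) (by positivity)
        exact mul_le_mul_of_nonneg_left (by linarith) hC.le
    _ = _ := by ring

theorem tendsto_scaledSummand_natCeil (hL : SlowlyVaryingAtTop L) {u : ℝ} (hu : 0 < u) :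
    Tendsto (fun n : ℕ => scaledSummand L d n ⌈n * u⌉₊) atTop
      (𝓝 (u ^ (d - 1) * (1 + u) ^ (d - 1))) := by
  have key : ∀ v : ℝ, 0 < v → Tendsto
      (fun n : ℕ => (((⌈n * v⌉₊ : ℕ) : ℝ) / n) ^ (d - 1) * (L (⌈n * v⌉₊ : ℕ) / L n)) atTop
      (𝓝 (v ^ (d - 1))) := by
    intro v hv
    have h1 : Tendsto (fun n : ℕ => ((⌈n * v⌉₊ : ℕ) : ℝ) / n) atTop (𝓝 v) := by
      have := (tendsto_nat_ceil_mul_div_atTop hv.le).comp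
        (tendsto_natCast_atTop_atTop (R := ℝ))
      refine this.congr fun n => ?_
      simp [mul_comm]
    simpa using (h1.rpow_const (Or.inl hv.ne')).mul (hL.tendsto_natCeil_div hv)
  have h2 := (key (1 + u) (by linarith)).mul (key u hu)
  rw [mul_comm] at h2
  refine h2.congr fun n => ?_
  have h3 : ⌈n * (1 + u)⌉₊ = n + ⌈n * u⌉₊ := by
    rw [mul_add, mul_one, add_comm, Nat.ceil_add_natCast (by positivity), add_comm]
  rw [h3, scaledSummand]

open MeasureTheory in
theorem tendsto_tsum_scaledSummand (hL : SlowlyVaryingAtTop L) (hd0 : 0 < d)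
    (hd2 : d < 1 / 2) :
    ∃ (K : ℝ) (s : ℕ → ℝ), Tendsto s atTop (𝓝 0) ∧
      (∀ᶠ n : ℕ in atTop, Summable (fun i => scaledSummand L d n (i + 1) / n) ∧
        ∑' i, |scaledSummand L d n (i + 1) / n| ≤ K ∧
        ∀ i, |scaledSummand L d n (i + 1) / n| ≤ s n) ∧
      Tendsto (fun n : ℕ => ∑' i, scaledSummand L d n (i + 1) / n) atTop
        (𝓝 (Real.Gamma d * Real.Gamma (1 - 2 * d) / Real.Gamma (1 - d))) := by
  obtain ⟨α, β, K, hβ, hβα, hα, hK, N, hN, h⟩ := hL.exists_abs_scaledSummand_le hd0 hd2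
  have hα0 : α ≤ 0 := by linarith
  have hβ0 : β ≤ 0 := by linarith
  let G : ℝ → ℝ := fun u => K * ((u ^ α * (1 + u) ^ α) + u ^ β * (1 + u) ^ α)
  have hG : IntegrableOn G (Set.Ioi 0) :=
    ((integrableOn_Ioi_rpow_mul_one_add_rpow (by linarith) hα0 hα).add
      (integrableOn_Ioi_rpow_mul_one_add_rpow hβ hα0 (by linarith))).const_mul K
  have hbound : ∀ n : ℕ, N ≤ n → ∀ u ∈ Set.Ioi (0 : ℝ),
      ‖scaledSummand L d n ⌈n * u⌉₊‖ ≤ G u := by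
    intro n hn u hu
    have hu0 : 0 < u := hu
    have hn0 : (0 : ℝ) < n := Nat.cast_pos.2 (hN.trans hn)
    refine ((h n hn).2 _ (Nat.ceil_pos.2 (mul_pos hn0 hu0))).trans ?_
    have hle : u ≤ ((⌈n * u⌉₊ : ℕ) : ℝ) / n := by
      rw [le_div_iff₀ hn0, mul_comm]
      exact Nat.le_ceil _
    have hrp : ∀ {x y p : ℝ}, 0 < x → x ≤ y → p ≤ 0 → y ^ p ≤ x ^ p :=
      fun hx hxy hp => Real.rpow_le_rpow_of_nonpos hx hxy hp
    have h1 := hrp hu0 hle hα0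
    have h2 := hrp hu0 hle hβ0
    have h3 := hrp (x := 1 + u) (by linarith) (add_le_add_right hle 1) hα0
    have h4 : 0 < ((⌈n * u⌉₊ : ℕ) : ℝ) / n := hu0.trans_le hle
    simp only [G]
    gcongr
  have hmeas : ∀ n : ℕ, AEStronglyMeasurable (fun u : ℝ => scaledSummand L d n ⌈n * u⌉₊)
      (volume.restrict (Set.Ioi 0)) := fun n =>
    ((measurable_from_top (f := scaledSummand L d n)).comp
      (Nat.measurable_ceil.comp (measurable_const_mul (n : ℝ)))).aestronglyMeasurable
  have hint : ∀ n : ℕ, N ≤ n →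
      IntegrableOn (fun u : ℝ => scaledSummand L d n ⌈n * u⌉₊) (Set.Ioi 0) := fun n hn =>
    Integrable.mono' hG (hmeas n)
      ((ae_restrict_iff' measurableSet_Ioi).2 (Eventually.of_forall (hbound n hn)))
  have hsum := fun (n : ℕ) (hn : N ≤ n) =>
    hasSum_of_integrableOn_natCeil (hN.trans hn) (hint n hn)
  refine ⟨∫ u in Set.Ioi (0 : ℝ), G u, fun n => 2 * K * (n : ℝ) ^ (-(1 + β)), ?_, ?_, ?_⟩
  · simpa using ((tendsto_rpow_neg_atTop (y := 1 + β) (by linarith)).comp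
      (tendsto_natCast_atTop_atTop (R := ℝ))).const_mul (2 * K)
  · filter_upwards [eventually_ge_atTop N] with n hn
    have hn0 : (0 : ℝ) < n := Nat.cast_pos.2 (hN.trans hn)
    have hn1 : (1 : ℝ) ≤ n := Nat.one_le_cast.2 (hN.trans hn)
    refine ⟨(hsum n hn).summable, ?_, fun i => ?_⟩
    · have habs := hasSum_of_integrableOn_natCeil (f := fun m => |scaledSummand L d n m|)
        (hN.trans hn) (hint n hn).abs
      simp_rw [abs_div, Nat.abs_cast]
      rw [habs.tsum_eq]
      exact setIntegral_mono_on (hint n hn).abs hG measurableSet_Ioi (hbound n hn)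
    · rw [abs_div, Nat.abs_cast, div_le_iff₀ hn0]
      refine ((h n hn).2 (i + 1) (by omega)).trans ?_
      set x := ((i + 1 : ℕ) : ℝ) / n
      have hx : (n : ℝ)⁻¹ ≤ x := by
        rw [← one_div]
        exact div_le_div_of_nonneg_right (by simp) hn0.le
      have hx0 : 0 < x := (inv_pos.2 hn0).trans_le hx
      have hpow : ∀ p, β ≤ p → p ≤ 0 → x ^ p ≤ (n : ℝ) ^ (-β) := fun p hp hp0 =>
        calc x ^ p ≤ ((n : ℝ)⁻¹) ^ p := Real.rpow_le_rpow_of_nonpos (by positivity) hx hp0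
          _ = (n : ℝ) ^ (-p) := by rw [Real.inv_rpow hn0.le, Real.rpow_neg hn0.le]
          _ ≤ (n : ℝ) ^ (-β) := Real.rpow_le_rpow_of_exponent_le hn1 (by linarith)
      have h1 := hpow α hβα hα0
      have h2 := hpow β le_rfl hβ0
      have h3 : (1 + x) ^ α ≤ 1 := Real.rpow_le_one_of_one_le_of_nonpos (by linarith) hα0
      have h4 : (n : ℝ) ^ (-(1 + β)) * n = (n : ℝ) ^ (-β) := by
        rw [← Real.rpow_add_one hn0.ne']
        congr 1
        ring
      have h5 : x ^ α * (1 + x) ^ α ≤ (n : ℝ) ^ (-β) :=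
        (mul_le_of_le_one_right (by positivity) h3).trans h1
      have h6 : x ^ β * (1 + x) ^ α ≤ (n : ℝ) ^ (-β) :=
        (mul_le_of_le_one_right (by positivity) h3).trans h2
      rw [mul_assoc (2 * K), h4]
      calc _ ≤ K * ((n : ℝ) ^ (-β) + (n : ℝ) ^ (-β)) :=
            mul_le_mul_of_nonneg_left (add_le_add h5 h6) hK.le
        _ = _ := by ring
  · rw [← integral_Ioi_rpow_mul_one_add_rpow hd0 hd2]
    have hlim : Tendsto (fun n : ℕ => ∫ u in Set.Ioi (0 : ℝ), scaledSummand L d n ⌈n * u⌉₊)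
        atTop (𝓝 (∫ u in Set.Ioi (0 : ℝ), u ^ (d - 1) * (1 + u) ^ (d - 1))) := by
      refine tendsto_integral_filter_of_dominated_convergence G
        (Eventually.of_forall hmeas) ?_ hG ?_
      · filter_upwards [eventually_ge_atTop N] with n hn
        exact (ae_restrict_iff' measurableSet_Ioi).2 (Eventually.of_forall (hbound n hn))
      · exact (ae_restrict_iff' measurableSet_Ioi).2
          (Eventually.of_forall fun u hu => hL.tendsto_scaledSummand_natCeil hu)
    refine hlim.congr' ?_
    filter_upwards [eventually_ge_atTop N] with n hn
    exact (hsum n hn).tsum_eq.symm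

theorem pow (hL : SlowlyVaryingAtTop L) (m : ℕ) : SlowlyVaryingAtTop fun x => L x ^ m := by
  refine ⟨hL.1.pow_const m, hL.2.1.mono fun x hx => pow_pos hx m, fun l hl => ?_⟩
  simpa only [div_pow, one_pow] using (hL.2.2 l hl).pow m

theorem const_mul (hL : SlowlyVaryingAtTop L) {c : ℝ} (hc : 0 < c) :
    SlowlyVaryingAtTop fun x => c * L x := by
  refine ⟨hL.1.const_mul c, hL.2.1.mono fun x hx => mul_pos hc hx, fun l hl => ?_⟩
  simpa only [mul_div_mul_left _ _ hc.ne'] using hL.2.2 l hl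

end SlowlyVaryingAtTop

/-- asymptotics of the autocovariance-type `k`-fold sum
`γ(n) = ∑_{1 ≤ i_1 < ⋯ < i_k} a_{n+i_1} a_{i_1} ⋯ a_{n+i_k} a_{i_k}`:
`γ(n) / (n^{k(2d-1)} L(n)^{2k}) → B(d, 1-2d)^k / k!`, and equivalently
`γ(n) = n^{2 d_X - 1} L*(n)` asymptotically, where `d_X = 1/2 - k(1/2-d)` and
`L*(x) = (k!)⁻¹ B(d,1-2d)^k L(x)^{2k}` is slowly varying. -/
theorem statement1 (k : ℕ) (hk : 1 ≤ k) (d : ℝ) (hd0 : 0 < d) (hd2 : d < 1 / 2)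
    (L : ℝ → ℝ) (hL : SlowlyVaryingAtTop L) (a : ℕ → ℝ)
    (ha : ∀ i : ℕ, 1 ≤ i → a i = (i : ℝ) ^ (d - 1) * L i)
    (γ : ℕ → ℝ)
    (hγ : ∀ n : ℕ, γ n = ∑' i : IncrTuple k, ∏ j, (a (n + i.1 j) * a (i.1 j)))
    (B : ℝ) (hB : B = Real.Gamma d * Real.Gamma (1 - 2 * d) / Real.Gamma (1 - d))
    (dX : ℝ) (hdX : dX = 1 / 2 - k * (1 / 2 - d))
    (Lstar : ℝ → ℝ) (hLstar : ∀ x : ℝ, Lstar x = ((k.factorial : ℝ))⁻¹ * B ^ k * L x ^ (2 * k)) :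
    Tendsto (fun n : ℕ => γ n / ((n : ℝ) ^ ((k : ℝ) * (2 * d - 1)) * L n ^ (2 * k)))
      atTop (𝓝 (B ^ k / (k.factorial : ℝ))) ∧
    SlowlyVaryingAtTop Lstar ∧
    Tendsto (fun n : ℕ => γ n / ((n : ℝ) ^ (2 * dX - 1) * Lstar n)) atTop (𝓝 1) := by
  have hB0 : 0 < B := by
    rw [hB]
    exact div_pos (mul_pos (Real.Gamma_pos_of_pos hd0) (Real.Gamma_pos_of_pos (by linarith)))
      (Real.Gamma_pos_of_pos (by linarith))
  have hmain : Tendsto (fun n : ℕ => γ n / ((n : ℝ) ^ ((k : ℝ) * (2 * d - 1)) * L n ^ (2 * k)))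
      atTop (𝓝 (B ^ k / (k.factorial : ℝ))) := by
    obtain ⟨K, s, hs, hc, hlim⟩ := hL.tendsto_tsum_scaledSummand hd0 hd2
    rw [← hB] at hlim
    refine (tendsto_infEsymm hs hc hlim k).congr' ?_
    filter_upwards [eventually_ge_atTop 1, tendsto_natCast_atTop_atTop.eventually hL.2.1]
      with n hn hLn
    rw [hγ, tsum_incrTuple (fun m => a (n + m) * a m)]
    have h1 : (fun i => scaledSummand L d n (i + 1) / n) = fun i =>
        ((n ^ (2 * d - 1) * L n ^ 2 : ℝ))⁻¹ * (a (n + (i + 1)) * a (i + 1)) := by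
      funext i
      rw [← mul_eq_scaledSummand_div hn hLn, ha (n + (i + 1)) (by omega), ha (i + 1) (by omega)]
    rw [h1, infEsymm_const_mul, inv_pow, mul_pow, ← pow_mul, ← Real.rpow_mul_natCast
      (Nat.cast_nonneg n), mul_comm (2 * d - 1), div_eq_inv_mul]
  have hcoef : 0 < ((k.factorial : ℝ))⁻¹ * B ^ k := by positivity
  refine ⟨hmain, ?_, ?_⟩
  · rw [funext hLstar]
    exact (hL.pow (2 * k)).const_mul hcoef
  · have h1 := hmain.div_const (((k.factorial : ℝ))⁻¹ * B ^ k)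
    rw [div_eq_inv_mul (B ^ k), div_self hcoef.ne'] at h1
    refine h1.congr fun n => ?_
    rw [hLstar, hdX, show 2 * (1 / 2 - k * (1 / 2 - d)) - 1 = (k : ℝ) * (2 * d - 1) by ring,
      div_div]
    congr 1
    ring
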